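/- Optimal sorting length for h = 2 and one empty bin: let S₀ be an initial configuration of capacity-2 bins with n full bins, exactly one empty bin, each color occurring exactly twice (|C| = n), and no full bin containing two units of the same color. If S₀ can reach a sorted configuration by water-moves, then the minimum length of a sequence of water-moves from S₀ to a sorted configuration equals n + ℓ, where ℓ is the number of cycles (connected components) of the underlying undirected multigraph G(S₀). -/

import Mathlib

open scoped Classical

noncomputable section

/-- A configuration: each bin holds a list of colors (bottom to top) of length at most `h`. -/
def Config {B C : Type*} (h : ℕ) (S : B → List C) : Prop := ∀ b, (S b).length ≤ h

/-- An initial configuration: every bin is full (length `h`) or empty. -/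
def InitConfig {B C : Type*} (h : ℕ) (S : B → List C) : Prop :=
  ∀ b, (S b).length = h ∨ (S b).length = 0

/-- A sorted (goal) configuration: every bin is empty or monochromatically full. -/
def SortedConfig {B C : Type*} (h : ℕ) (S : B → List C) : Prop :=
  ∀ b, S b = [] ∨ ∃ c, S b = List.replicate h c

/-- A water-move from `S` to `S'` with bins of capacity `h`. -/
def WaterMove {B C : Type*} (h : ℕ) (S S' : B → List C) : Prop :=
  ∃ b₁ b₂ c m, 1 ≤ m ∧ b₁ ≠ b₂ ∧
    S b₁ = S' b₁ ++ List.replicate m c ∧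
    (S b₂ = [] ∨ (S b₂).getLast? = some c) ∧
    S' b₂ = S b₂ ++ List.replicate m c ∧ (S' b₂).length ≤ h ∧
    ((S' b₁).getLast? ≠ some c ∨ (S' b₂).length = h) ∧
    ∀ b, b ≠ b₁ → b ≠ b₂ → S' b = S b

/-- The indegree of the color `c` in the directed multigraph `G⃗(S)` (capacity 2): the number
of full bins whose top unit has color `c`. -/
def indeg {B C : Type*} [Fintype B] (S : B → List C) (c : C) : ℕ :=
  (Finset.univ.filter (fun b => (S b).length = 2 ∧ (S b)[1]? = some c)).card

/-- The outdegree of the color `c` in `G⃗(S)` (capacity 2): the number of full bins whose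
bottom unit has color `c`. -/
def outdeg {B C : Type*} [Fintype B] (S : B → List C) (c : C) : ℕ :=
  (Finset.univ.filter (fun b => (S b).length = 2 ∧ (S b)[0]? = some c)).card

/-- A set `A` of bins forms a directed cycle of `G⃗(S)` that is not a self-loop: the bins of
`A` can be arranged in a cyclic order of length at least 2 in which the top color of each bin
is the bottom color of the next. -/
def IsCycleSet {B C : Type*} (S : B → List C) (A : Finset B) : Prop :=
  ∃ l : List B, l.Nodup ∧ l.toFinset = A ∧ 2 ≤ l.length ∧
    (∀ b ∈ l, (S b).length = 2) ∧
    List.Chain' (fun b b' => (S b)[1]? = (S b')[0]?) l ∧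
    ∀ bl ∈ l.getLast?, ∀ bh ∈ l.head?, (S bl)[1]? = (S bh)[0]?

/-- `p_S`: the number of directed cycles of `G⃗(S)` that are not self-loops (each such cycle
being identified with its set of bins/edges). -/
def pS {B C : Type*} [Fintype B] [DecidableEq B] (S : B → List C) : ℕ :=
  (Finset.univ.filter (fun A : Finset B => IsCycleSet S A)).card

/-- `q_S`: the number of vertices of indegree 2 in `G⃗(S)`. -/
def qS {B C : Type*} [Fintype B] [Fintype C] (S : B → List C) : ℕ :=
  (Finset.univ.filter (fun c : C => indeg S c = 2)).card

/-- `r_S`: the number of colors that are not sorted (the two units of the color do not lie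
in the same bin). -/
def rS {B C : Type*} [Fintype B] [Fintype C] [DecidableEq C] (S : B → List C) : ℕ :=
  (Finset.univ.filter (fun c : C => ¬ ∃ b, (S b).count c = 2)).card

/-- Adjacency in the underlying undirected multigraph `G(S)`: some full bin joins `c` and
`c'`. -/
def adj {B C : Type*} (S : B → List C) (c c' : C) : Prop :=
  ∃ b, S b = [c, c'] ∨ S b = [c', c]

/-- The number of connected components (cycles) of the underlying multigraph `G(S)` on the
color set. -/
def numComponents {B C : Type*} [Fintype C] (S : B → List C) : ℕ :=
  (Finset.univ.image
    (fun c : C => Finset.univ.filter (fun c' => Relation.ReflTransGen (adj S) c c'))).card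

end

section Sorting

variable {B C : Type*}

/-- `Pour S S' b₁ b₂ c` lists the possible contents of the source `b₁` and the target `b₂` before
and after a water-move of color `c` with capacity 2. -/
def Pour (S S' : B → List C) (b₁ b₂ : B) (c : C) : Prop :=
  (∃ x, x ≠ c ∧ S b₁ = [x, c] ∧ S' b₁ = [x] ∧ S b₂ = [] ∧ S' b₂ = [c]) ∨
  (∃ x, S b₁ = [x, c] ∧ S' b₁ = [x] ∧ S b₂ = [c] ∧ S' b₂ = [c, c]) ∨
  (S b₁ = [c] ∧ S' b₁ = [] ∧ S b₂ = [] ∧ S' b₂ = [c]) ∨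
  (S b₁ = [c] ∧ S' b₁ = [] ∧ S b₂ = [c] ∧ S' b₂ = [c, c]) ∨
  (S b₁ = [c, c] ∧ S' b₁ = [] ∧ S b₂ = [] ∧ S' b₂ = [c, c])

theorem WaterMove.exists_pour {S S' : B → List C} (hS : Config 2 S) (h : WaterMove 2 S S') :
    ∃ b₁ b₂ c, b₁ ≠ b₂ ∧ (∀ b, b ≠ b₁ → b ≠ b₂ → S' b = S b) ∧ Pour S S' b₁ b₂ c := by
  obtain ⟨b₁, b₂, c, m, hm, hne, h1, h2, h3, h4, h5, h6⟩ := h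
  refine ⟨b₁, b₂, c, hne, h6, ?_⟩
  have l1 := hS b₁
  unfold Pour
  generalize S b₁ = u at *
  generalize S' b₁ = u' at *
  generalize S b₂ = v at *
  generalize S' b₂ = v' at *
  subst h1 h3
  have hm2 : m ≤ 2 := by simp at l1; omega
  have hcase : m = 1 ∨ m = 2 := by omega
  rcases hcase with rfl | rfl
  · rcases u' with _ | ⟨x, _ | ⟨y, t⟩⟩
    · rcases v with _ | ⟨z, _ | ⟨w, t⟩⟩
      · simp
      · simp_all
      · simp at h4
    · rcases v with _ | ⟨z, _ | ⟨w, t⟩⟩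
      · simp_all
      · simp_all
      · simp at h4
    · simp at l1
  · rcases u' with _ | ⟨x, t⟩
    · rcases v with _ | ⟨z, t⟩
      · simp [List.replicate]
      · simp at h4
    · simp at l1

theorem WaterMove.config {S S' : B → List C} (hS : Config 2 S) (h : WaterMove 2 S S') :
    Config 2 S' := by
  obtain ⟨b₁, b₂, c, hne, hother, hp⟩ := h.exists_pour hS
  intro b
  have hb := hS b
  by_cases h1 : b = b₁
  · subst h1
    rcases hp with ⟨x, _, h⟩ | ⟨x, h⟩ | h | h | h <;> simp [h]
  by_cases h2 : b = b₂
  · subst h2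
    rcases hp with ⟨x, _, h⟩ | ⟨x, h⟩ | h | h | h <;> simp [h]
  · rw [hother b h1 h2]; exact hb

theorem WaterMove.comp_equiv {h : ℕ} {S S' : B → List C} (σ : Equiv.Perm B)
    (hm : WaterMove h S S') : WaterMove h (S ∘ σ) (S' ∘ σ) := by
  obtain ⟨b₁, b₂, c, m, hm, hne, h1, h2, h3, h4, h5, h6⟩ := hm
  refine ⟨σ.symm b₁, σ.symm b₂, c, m, hm, by simpa using hne, by simpa using h1, by simpa using h2,
    by simpa using h3, by simpa using h4, by simpa using h5, fun b hb1 hb2 => ?_⟩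
  exact h6 _ (fun e => hb1 (by simp [← e])) (fun e => hb2 (by simp [← e]))

/-- `S` can be sorted by exactly `k` water-moves. -/
def SortableIn (k : ℕ) (S : B → List C) : Prop :=
  ∃ f : ℕ → B → List C, f 0 = S ∧ (∀ i < k, WaterMove 2 (f i) (f (i + 1))) ∧ SortedConfig 2 (f k)

theorem SortableIn.cons {k : ℕ} {S S' : B → List C} (hm : WaterMove 2 S S')
    (h : SortableIn k S') : SortableIn (k + 1) S := by
  obtain ⟨f, rfl, hf, hs⟩ := h
  refine ⟨fun i => Nat.casesOn i S f, rfl, ?_, hs⟩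
  rintro (_ | i) hi
  · exact hm
  · exact hf i (by omega)

theorem SortableIn.comp_equiv {k : ℕ} {S : B → List C} (σ : Equiv.Perm B)
    (h : SortableIn k S) : SortableIn k (S ∘ σ) := by
  obtain ⟨f, rfl, hf, hs⟩ := h
  exact ⟨fun i => f i ∘ σ, rfl, fun i hi => (hf i hi).comp_equiv σ, fun b => hs (σ b)⟩

/-! ### The potential -/

theorem adj_symm {S : B → List C} {c d : C} (h : adj S c d) : adj S d c := by
  obtain ⟨b, hb⟩ := h
  exact ⟨b, hb.symm⟩

theorem reach_symm {S : B → List C} {c d : C} (h : Relation.ReflTransGen (adj S) c d) :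
    Relation.ReflTransGen (adj S) d c :=
  have : Std.Symm (adj S) := ⟨fun _ _ => adj_symm⟩
  Relation.ReflTransGen.stdSymm.symm _ _ h

theorem reach_congr {S S' : B → List C} {d : C}
    (h : ∀ e, Relation.ReflTransGen (adj S) d e → ∀ f, adj S e f ↔ adj S' e f) (e : C) :
    Relation.ReflTransGen (adj S) d e ↔ Relation.ReflTransGen (adj S') d e := by
  constructor
  · intro he
    induction he with
    | refl => exact .refl
    | tail h1 h2 ih => exact ih.tail ((h _ h1 _).1 h2)
  · intro he
    induction he with
    | refl => exact .refl
    | tail h1 h2 ih => exact ih.tail ((h _ ih _).2 h2)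

/-- No color in the component of `d` is sorted or lies alone in a bin: the component is a cycle
of length at least 2. -/
def OnCycle (S : B → List C) (d : C) : Prop :=
  ∀ e, Relation.ReflTransGen (adj S) d e → ∀ b, S b ≠ [e] ∧ S b ≠ [e, e]

noncomputable section

/-- The component of the color `c`. -/
def colorClass [Fintype C] (S : B → List C) (c : C) : Finset C :=
  Finset.univ.filter (fun d => Relation.ReflTransGen (adj S) c d)

/-- The components that are cycles of length at least 2. -/
def cycleClasses [Fintype C] (S : B → List C) : Finset (Finset C) :=
  (Finset.univ.filter (OnCycle S)).image (colorClass S)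

/-- The colors whose two units do not form a bin. -/
def unsortedColors [Fintype C] (S : B → List C) : Finset C :=
  Finset.univ.filter (fun c => ∀ b, S b ≠ [c, c])

/-- The potential: unsorted colors plus nontrivial cycles. -/
def potential [Fintype C] (S : B → List C) : ℕ :=
  (unsortedColors S).card + (cycleClasses S).card

end

theorem mem_cycleClasses [Fintype C] {S : B → List C} {K : Finset C} :
    K ∈ cycleClasses S ↔ ∃ d, OnCycle S d ∧ colorClass S d = K := by
  simp [cycleClasses]

theorem mem_unsortedColors [Fintype C] {S : B → List C} {c : C} :
    c ∈ unsortedColors S ↔ ∀ b, S b ≠ [c, c] := by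
  simp [unsortedColors]

theorem colorClass_eq_of_reach [Fintype C] {S : B → List C} {c d : C}
    (h : Relation.ReflTransGen (adj S) d c) : colorClass S d = colorClass S c := by
  ext e
  simp only [colorClass, Finset.mem_filter, Finset.mem_univ, true_and]
  exact ⟨fun he => (reach_symm h).trans he, fun he => h.trans he⟩

theorem colorClass_congr [Fintype C] {S S' : B → List C} {d : C}
    (h : ∀ e, Relation.ReflTransGen (adj S) d e ↔ Relation.ReflTransGen (adj S') d e) :
    colorClass S d = colorClass S' d := by
  ext e
  simp [colorClass, h]

theorem potential_comp_equiv [Fintype C] (S : B → List C) (σ : Equiv.Perm B) :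
    potential (S ∘ σ) = potential S := by
  have hadj : adj (S ∘ σ) = adj S := by
    ext c d
    exact (σ.surjective.exists (p := fun b => S b = [c, d] ∨ S b = [d, c])).symm
  have hon : OnCycle (S ∘ σ) = OnCycle S := by
    ext d
    unfold OnCycle
    rw [hadj]
    exact forall₂_congr fun e _ =>
      (σ.surjective.forall (p := fun b => S b ≠ [e] ∧ S b ≠ [e, e])).symm
  have hclass : colorClass (S ∘ σ) = colorClass S := by
    unfold colorClass
    rw [hadj]
  have huns : unsortedColors (S ∘ σ) = unsortedColors S := by
    ext c
    rw [mem_unsortedColors, mem_unsortedColors]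
    exact (σ.surjective.forall (p := fun b => S b ≠ [c, c])).symm
  unfold potential cycleClasses
  rw [hon, hclass, huns]

section Pour

variable {S S' : B → List C} {b₁ b₂ : B} {c : C}

/-- A move of color `c` affects, among the edges at colors other than `c`, only the source. -/
theorem Pour.adj_iff (hother : ∀ b, b ≠ b₁ → b ≠ b₂ → S' b = S b)
    (hp : Pour S S' b₁ b₂ c) {e f : C} (he : e ≠ c) (hb₁ : S b₁ ≠ [e, c]) :
    adj S e f ↔ adj S' e f := by
  refine exists_congr fun b => ?_
  by_cases h1 : b = b₁
  · subst h1
    rcases hp with ⟨x, _, h⟩ | ⟨x, h⟩ | h | h | h <;> simp [h] at hb₁ ⊢ <;> grind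
  by_cases h2 : b = b₂
  · subst h2
    rcases hp with ⟨x, _, h⟩ | ⟨x, h⟩ | h | h | h <;> simp [h] <;> grind
  · rw [hother b h1 h2]

/-- For a color `e ≠ c` that is not left alone in the source, a move of color `c` does not change
the bins `[e]` and `[e, e]`. -/
theorem Pour.mono_iff (hother : ∀ b, b ≠ b₁ → b ≠ b₂ → S' b = S b)
    (hp : Pour S S' b₁ b₂ c) {e : C} (he : e ≠ c) (hb₁ : S b₁ ≠ [e, c]) (b : B) :
    (S b ≠ [e] ∧ S b ≠ [e, e]) ↔ (S' b ≠ [e] ∧ S' b ≠ [e, e]) := by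
  by_cases h1 : b = b₁
  · subst h1
    rcases hp with ⟨x, _, h⟩ | ⟨x, h⟩ | h | h | h <;> simp [h] at hb₁ ⊢ <;> grind
  by_cases h2 : b = b₂
  · subst h2
    rcases hp with ⟨x, _, h⟩ | ⟨x, h⟩ | h | h | h <;> simp [h] <;> grind
  · rw [hother b h1 h2]

/-- Cycles avoiding the moved color persist. -/
theorem Pour.onCycle (hother : ∀ b, b ≠ b₁ → b ≠ b₂ → S' b = S b)
    (hp : Pour S S' b₁ b₂ c) {d : C} (hd : OnCycle S d)
    (hdc : ¬ Relation.ReflTransGen (adj S) d c) :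
    OnCycle S' d ∧ ∀ e, Relation.ReflTransGen (adj S) d e ↔ Relation.ReflTransGen (adj S') d e := by
  have hne : ∀ e, Relation.ReflTransGen (adj S) d e → e ≠ c ∧ S b₁ ≠ [e, c] := fun e he =>
    ⟨fun h => hdc (h ▸ he), fun h => hdc (he.tail ⟨b₁, .inl h⟩)⟩
  have hr := reach_congr (S' := S') fun e he f => hp.adj_iff hother (hne e he).1 (hne e he).2
  refine ⟨fun e he b => ?_, hr⟩
  rw [← hr] at he
  exact (hp.mono_iff hother (hne e he).1 (hne e he).2 b).1 (hd e he b)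

/-- A move that is not a transfer of a sorted pair creates no cycles. -/
theorem Pour.onCycle_of_onCycle (hother : ∀ b, b ≠ b₁ → b ≠ b₂ → S' b = S b)
    (hp : Pour S S' b₁ b₂ c) {d : C} (hd : OnCycle S' d) (hcc : S b₁ ≠ [c, c]) :
    OnCycle S d ∧ ¬ Relation.ReflTransGen (adj S) d c ∧
      ∀ e, Relation.ReflTransGen (adj S') d e ↔ Relation.ReflTransGen (adj S) d e := by
  have hne : ∀ e, Relation.ReflTransGen (adj S') d e → e ≠ c ∧ S b₁ ≠ [e, c] := by
    intro e he
    have h1 := hd e he b₁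
    have h2 := hd e he b₂
    rcases hp with ⟨x, _, h⟩ | ⟨x, h⟩ | h | h | h <;> simp [h] at h1 h2 hcc ⊢ <;> grind
  have hr := reach_congr (S' := S)
    fun e he f => (hp.adj_iff hother (f := f) (hne e he).1 (hne e he).2).symm
  refine ⟨fun e he b => ?_, fun h => (hne c ((hr c).2 h)).1 rfl, hr⟩
  rw [← hr] at he
  exact (hp.mono_iff hother (hne e he).1 (hne e he).2 b).2 (hd e he b)

theorem Pour.cycleClasses_subset [Fintype C] (hother : ∀ b, b ≠ b₁ → b ≠ b₂ → S' b = S b)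
    (hp : Pour S S' b₁ b₂ c) {K : Finset C} (hK : K ∈ cycleClasses S) :
    (K = colorClass S c ∧ OnCycle S c) ∨ K ∈ cycleClasses S' := by
  obtain ⟨d, hd, rfl⟩ := mem_cycleClasses.1 hK
  by_cases hdc : Relation.ReflTransGen (adj S) d c
  · exact .inl ⟨colorClass_eq_of_reach hdc, fun e he => hd e (hdc.trans he)⟩
  · obtain ⟨h1, h2⟩ := hp.onCycle hother hd hdc
    exact .inr (mem_cycleClasses.2 ⟨d, h1, (colorClass_congr h2).symm⟩)

theorem Pour.cycleClasses_subset_of_ne [Fintype C]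
    (hother : ∀ b, b ≠ b₁ → b ≠ b₂ → S' b = S b)
    (hp : Pour S S' b₁ b₂ c) (hcc : S b₁ ≠ [c, c]) :
    cycleClasses S' ⊆ cycleClasses S ∧ colorClass S c ∉ cycleClasses S' := by
  refine ⟨fun K hK => ?_, fun hK => ?_⟩
  · obtain ⟨d, hd, rfl⟩ := mem_cycleClasses.1 hK
    obtain ⟨h1, -, h3⟩ := hp.onCycle_of_onCycle hother hd hcc
    exact mem_cycleClasses.2 ⟨d, h1, (colorClass_congr h3).symm⟩
  · obtain ⟨d, hd, heq⟩ := mem_cycleClasses.1 hK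
    obtain ⟨-, h2, h3⟩ := hp.onCycle_of_onCycle hother hd hcc
    have : c ∈ colorClass S' d := by rw [heq]; simp [colorClass, Relation.ReflTransGen.refl]
    exact h2 ((h3 c).1 (by simpa [colorClass] using this))

/-- If a move sorts `c`, the target was `[c]`; no other color becomes sorted. -/
theorem Pour.unsortedColors_subset [Fintype C] (hother : ∀ b, b ≠ b₁ → b ≠ b₂ → S' b = S b)
    (hp : Pour S S' b₁ b₂ c) {d : C} (hd : d ∈ unsortedColors S) :
    (d = c ∧ S b₂ = [c]) ∨ d ∈ unsortedColors S' := by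
  rw [mem_unsortedColors] at hd ⊢
  by_contra! hcon
  obtain ⟨hc, b, hb⟩ := hcon
  have h1 := hd b
  have h2 := hd b₁
  by_cases hb1 : b = b₁
  · subst hb1
    rcases hp with ⟨x, _, h⟩ | ⟨x, h⟩ | h | h | h <;> simp [h] at hb
  by_cases hb2 : b = b₂
  · subst hb2
    rcases hp with ⟨x, _, h⟩ | ⟨x, h⟩ | h | h | h <;> simp [h] at hb hc h2 <;> grind
  · exact h1 (hother b hb1 hb2 ▸ hb)

theorem WaterMove.potential_le [Fintype C] (hS : Config 2 S) (h : WaterMove 2 S S') :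
    potential S ≤ potential S' + 1 := by
  obtain ⟨b₁, b₂, c, hne, hother, hp⟩ := h.exists_pour hS
  by_cases hb : S b₂ = [c]
  · have h1 : unsortedColors S ⊆ insert c (unsortedColors S') := fun d hd => by
      rcases hp.unsortedColors_subset hother hd with h | h <;> simp [h]
    have h2 : cycleClasses S ⊆ cycleClasses S' := fun K hK => by
      rcases hp.cycleClasses_subset hother hK with h | h
      · exact absurd hb (h.2 c .refl b₂).1
      · exact h
    have h3 := (Finset.card_le_card h1).trans (Finset.card_insert_le _ _)
    have h4 := Finset.card_le_card h2
    unfold potential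
    omega
  · have h1 : unsortedColors S ⊆ unsortedColors S' := fun d hd => by
      rcases hp.unsortedColors_subset hother hd with h | h
      · exact absurd h.2 hb
      · exact h
    have h2 : cycleClasses S ⊆ insert (colorClass S c) (cycleClasses S') := fun K hK => by
      rcases hp.cycleClasses_subset hother hK with h | h <;> simp [h]
    have h3 := (Finset.card_le_card h2).trans (Finset.card_insert_le _ _)
    have h4 := Finset.card_le_card h1
    unfold potential
    omega

end Pour

/-! ### Counting units -/

section Count

variable [Fintype B] [DecidableEq C]

theorem WaterMove.sum_count {h : ℕ} {S S' : B → List C} (hm : WaterMove h S S') (d : C) :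
    ∑ b, (S' b).count d = ∑ b, (S b).count d := by
  obtain ⟨b₁, b₂, c, m, -, hne, h1, -, h3, -, -, h6⟩ := hm
  have hsplit : ∀ T : B → List C, ∑ b, (T b).count d =
      (T b₁).count d + ((T b₂).count d + ∑ b ∈ (Finset.univ.erase b₁).erase b₂, (T b).count d) := by
    intro T
    rw [Finset.add_sum_erase _ (fun b => (T b).count d) (by simp [hne.symm]),
      Finset.add_sum_erase _ (fun b => (T b).count d) (by simp)]
  rw [hsplit S, hsplit S', h1, h3]
  have : ∑ b ∈ (Finset.univ.erase b₁).erase b₂, (S' b).count d =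
      ∑ b ∈ (Finset.univ.erase b₁).erase b₂, (S b).count d :=
    Finset.sum_congr rfl fun b hb => by
      simp only [Finset.mem_erase] at hb
      rw [h6 b hb.2.1 hb.1]
  rw [this]
  simp only [List.count_append]
  omega

theorem count_add_count_le {S : B → List C} {c : C} (h : ∑ b, (S b).count c = 2) {b b' : B}
    (hne : b ≠ b') : (S b).count c + (S b').count c ≤ 2 := by
  rw [← h, ← Finset.sum_pair hne (f := fun b => (S b).count c)]
  exact Finset.sum_le_sum_of_subset (Finset.subset_univ _)

theorem sum_length [Fintype C] {S : B → List C} (h : ∀ c, ∑ b, (S b).count c = 2) :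
    ∑ b, (S b).length = 2 * Fintype.card C := by
  have h1 : ∀ b, (S b).length = ∑ c, (S b).count c := fun b => by
    have := Multiset.sum_count_eq_card (s := Finset.univ) (m := (S b : Multiset C)) (by simp)
    simpa using this.symm
  simp_rw [h1]
  rw [Finset.sum_comm]
  simp [h, mul_comm]

/-- With one spare bin, an empty bin forces all others to be full. -/
theorem length_eq_two_of_empty [Fintype C] {S : B → List C} (hS : Config 2 S)
    (h : ∀ c, ∑ b, (S b).count c = 2) (hcard : Fintype.card B = Fintype.card C + 1)
    {b b' : B} (hb : S b = []) (hne : b' ≠ b) : (S b').length = 2 := by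
  have h1 := sum_length h
  have h2 : ∑ x ∈ Finset.univ.erase b, (S x).length = ∑ x ∈ Finset.univ.erase b, 2 := by
    rw [← Finset.add_sum_erase _ _ (Finset.mem_univ b), hb] at h1
    simp only [List.length_nil, zero_add] at h1
    rw [h1, Finset.sum_const, Finset.card_erase_of_mem (Finset.mem_univ b), Finset.card_univ, hcard]
    simp [mul_comm]
  exact (Finset.sum_eq_sum_iff_of_le fun x _ => hS x).1 h2 b' (by simp [hne])

theorem SortedConfig.potential_eq_zero [Fintype C] {S : B → List C} (hs : SortedConfig 2 S)
    (h : ∀ c, ∑ b, (S b).count c = 2) : potential S = 0 := by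
  have key : ∀ c, ∃ b, S b = [c, c] := fun c => by
    obtain ⟨b, -, hb⟩ := Finset.exists_ne_zero_of_sum_ne_zero ((h c).trans_ne two_ne_zero)
    refine ⟨b, ?_⟩
    rcases hs b with h | ⟨d, h⟩
    · simp [h] at hb
    · have hmem : c ∈ S b := List.count_pos_iff.1 (Nat.pos_of_ne_zero hb)
      rw [h] at hmem
      rw [h, (List.mem_replicate.1 hmem).2]
      rfl
  have h1 : unsortedColors S = ∅ := by
    ext c
    simp [mem_unsortedColors, key c]
  have h2 : cycleClasses S = ∅ := by
    refine Finset.eq_empty_of_forall_notMem fun K hK => ?_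
    obtain ⟨d, hd, -⟩ := mem_cycleClasses.1 hK
    obtain ⟨b, hb⟩ := key d
    exact (hd d .refl b).2 hb
  simp [potential, h1, h2]

/-- A sorted color is isolated. -/
theorem eq_of_reach_sorted {S : B → List C} (h : ∀ c, ∑ b, (S b).count c = 2) {c e : C}
    (hr : Relation.ReflTransGen (adj S) c e) {b : B} (hb : S b = [e, e]) : c = e := by
  induction hr using Relation.ReflTransGen.head_induction_on with
  | refl => rfl
  | head h1 _ ih =>
    rw [ih] at h1
    obtain ⟨b', hb'⟩ := h1
    by_cases hbb : b = b'
    · subst hbb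
      simp [hb] at hb'
      grind
    · have := count_add_count_le (h e) hbb
      rcases hb' with hb' | hb' <;> simp [hb, hb', List.count_cons] at this

/-- With one spare bin, every move decreases the potential or transfers a sorted pair. -/
theorem WaterMove.potential_lt_or_swap [Fintype C] [DecidableEq B] {S S' : B → List C}
    (hS : Config 2 S) (h : ∀ c, ∑ b, (S b).count c = 2)
    (hcard : Fintype.card B = Fintype.card C + 1) (hm : WaterMove 2 S S') :
    potential S' + 1 ≤ potential S ∨ ∃ σ : Equiv.Perm B, S = S' ∘ σ := by
  obtain ⟨b₁, b₂, c, hne, hother, hp⟩ := hm.exists_pour hS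
  by_cases hcc : S b₁ = [c, c]
  · right
    refine ⟨Equiv.swap b₁ b₂, funext fun b => ?_⟩
    have hb₂ : S b₂ = [] ∧ S' b₁ = [] ∧ S' b₂ = [c, c] := by
      have := count_add_count_le (h c) hne
      rcases hp with ⟨x, _, h⟩ | ⟨x, h⟩ | h | h | h <;> simp_all
    by_cases h1 : b = b₁
    · simp [h1, hb₂, hcc]
    by_cases h2 : b = b₂
    · simp [h2, hb₂]
    · simp [Equiv.swap_apply_of_ne_of_ne h1 h2, hother b h1 h2]
  left
  obtain ⟨hcyc, hnot⟩ := hp.cycleClasses_subset_of_ne hother hcc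
  have huns : unsortedColors S' ⊆ unsortedColors S := fun d hd => by
    rw [mem_unsortedColors] at hd ⊢
    intro b hb
    refine hd b ?_
    have hb1 : b ≠ b₁ := by
      rintro rfl
      rcases hp with ⟨x, _, h⟩ | ⟨x, h⟩ | h | h | h <;> simp [h] at hb hcc <;> grind
    have hb2 : b ≠ b₂ := by
      rintro rfl
      rcases hp with ⟨x, _, h⟩ | ⟨x, h⟩ | h | h | h <;> simp [h] at hb
    rw [hother b hb1 hb2, hb]
  have hc : c ∈ unsortedColors S := by
    rw [mem_unsortedColors]
    intro b hb
    have hbne : b ≠ b₁ := by rintro rfl; exact hcc hb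
    have := count_add_count_le (h c) hbne
    rcases hp with ⟨x, _, h⟩ | ⟨x, h⟩ | h | h | h <;>
      simp [h, hb, List.count_cons] at this
  have hcard1 := Finset.card_le_card hcyc
  have hcard2 := Finset.card_le_card huns
  unfold potential
  by_cases hb₂ : S b₂ = []
  · have hfull : ∀ b, S b ≠ [] → (S b).length = 2 := fun b hb =>
      length_eq_two_of_empty hS h hcard hb₂ (by rintro rfl; exact hb hb₂)
    have hon : OnCycle S c := by
      refine fun e he b => ⟨fun hb => ?_, fun hb => ?_⟩
      · have := hfull b (by simp [hb])
        simp [hb] at this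
      · have := eq_of_reach_sorted h he hb
        subst this
        exact mem_unsortedColors.1 hc b hb
    have hmem : colorClass S c ∈ cycleClasses S := mem_cycleClasses.2 ⟨c, hon, rfl⟩
    have : (cycleClasses S').card < (cycleClasses S).card :=
      Finset.card_lt_card (Finset.ssubset_iff_of_subset hcyc |>.2 ⟨_, hmem, hnot⟩)
    omega
  · have hs : S' b₂ = [c, c] := by
      rcases hp with ⟨x, _, h⟩ | ⟨x, h⟩ | h | h | h <;> simp_all
    have hlt : (unsortedColors S').card < (unsortedColors S).card :=
      Finset.card_lt_card (Finset.ssubset_iff_of_subset huns |>.2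
        ⟨c, hc, fun h => mem_unsortedColors.1 h b₂ hs⟩)
    omega

theorem exists_sortableIn_le_potential [Fintype C] [DecidableEq B]
    (hcard : Fintype.card B = Fintype.card C + 1) {S T : B → List C}
    (hr : Relation.ReflTransGen (WaterMove 2) S T) (hT : SortedConfig 2 T) (hS : Config 2 S)
    (h : ∀ c, ∑ b, (S b).count c = 2) : ∃ k ≤ potential S, SortableIn k S := by
  induction hr using Relation.ReflTransGen.head_induction_on with
  | refl => exact ⟨0, Nat.zero_le _, fun _ => T, rfl, by simp, hT⟩
  | head hm _ ih =>
    obtain ⟨k, hk, hsol⟩ := ih (hm.config hS) fun c => (hm.sum_count c).trans (h c)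
    rcases hm.potential_lt_or_swap hS h hcard with hlt | ⟨σ, rfl⟩
    · exact ⟨k + 1, by omega, hsol.cons hm⟩
    · exact ⟨k, by rwa [potential_comp_equiv], hsol.comp_equiv σ⟩

theorem SortableIn.potential_le [Fintype C] {k : ℕ} {S : B → List C} (hs : SortableIn k S)
    (hS : Config 2 S) (h : ∀ c, ∑ b, (S b).count c = 2) : potential S ≤ k := by
  obtain ⟨f, rfl, hf, hsort⟩ := hs
  have key : ∀ i ≤ k, Config 2 (f i) ∧ (∀ c, ∑ b, (f i b).count c = 2) ∧
      potential (f 0) ≤ potential (f i) + i := by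
    intro i
    induction i with
    | zero => exact fun _ => ⟨hS, h, le_rfl⟩
    | succ i ih =>
      intro hi
      obtain ⟨h1, h2, h3⟩ := ih (by omega)
      have hm := hf i (by omega)
      have := hm.potential_le h1
      exact ⟨hm.config h1, fun c => (hm.sum_count c).trans (h2 c), by omega⟩
  obtain ⟨-, h2, h3⟩ := key k le_rfl
  rw [hsort.potential_eq_zero h2] at h3
  omega

end Count

theorem potential_of_initConfig [Fintype C] {S : B → List C} (hS : InitConfig 2 S)
    (hnoself : ∀ b c, S b ≠ [c, c]) : potential S = Fintype.card C + numComponents S := by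
  have h1 : unsortedColors S = Finset.univ := by
    ext c
    simp [mem_unsortedColors, hnoself]
  have h2 : Finset.univ.filter (OnCycle S) = Finset.univ := by
    refine Finset.filter_true_of_mem fun d _ e _ b => ⟨fun hb => ?_, hnoself b e⟩
    have := hS b
    simp [hb] at this
  have h3 : (cycleClasses S).card = numComponents S := by
    rw [cycleClasses, h2]
    rfl
  rw [potential, h1, h3, Finset.card_univ]

end Sorting

/-- optimal sorting length for capacity 2 and one empty bin: for a solvable
instance, the minimum length of a sorting sequence of water-moves equals `n + ℓ` where `ℓ`
is the number of cycles (connected components) of `G(S₀)`. -/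
theorem statement_17 {B C : Type*} [Fintype B] [Fintype C] [DecidableEq B] [DecidableEq C]
    (n : ℕ) (S₀ : B → List C) (hInit : InitConfig 2 S₀)
    (hfull : (Finset.univ.filter (fun b : B => (S₀ b).length = 2)).card = n)
    (hempty : (Finset.univ.filter (fun b : B => S₀ b = [])).card = 1)
    (htwice : ∀ c : C, ∑ b, (S₀ b).count c = 2)
    (hC : Fintype.card C = n)
    (hnoself : ∀ b c, S₀ b ≠ [c, c])
    (hsolv : ∃ T : B → List C, SortedConfig 2 T ∧ Relation.ReflTransGen (WaterMove 2) S₀ T) :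
    IsLeast {ℓ' : ℕ | ∃ f : ℕ → B → List C,
        f 0 = S₀ ∧ (∀ i < ℓ', WaterMove 2 (f i) (f (i + 1))) ∧ SortedConfig 2 (f ℓ')}
      (n + numComponents S₀) := by
  have hconf : Config 2 S₀ := fun b => by rcases hInit b with h | h <;> omega
  have hcard : Fintype.card B = Fintype.card C + 1 := by
    rw [hC, ← hfull, ← hempty, ← Finset.card_univ,
      ← Finset.card_filter_add_card_filter_not (s := Finset.univ) (fun b : B => (S₀ b).length = 2)]
    congr 2
    ext b
    rcases hInit b with h | h
    · have : S₀ b ≠ [] := by rintro h'; simp [h'] at h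
      simp [h, this]
    · simp [List.length_eq_zero_iff.1 h]
  rw [← hC, ← potential_of_initConfig hInit hnoself]
  have hlower : ∀ k, SortableIn k S₀ → potential S₀ ≤ k := fun k hk =>
    hk.potential_le hconf htwice
  obtain ⟨T, hT, hr⟩ := hsolv
  obtain ⟨k, hk, hsol⟩ := exists_sortableIn_le_potential hcard hr hT hconf htwice
  refine ⟨?_, fun k hk => hlower k hk⟩
  rw [le_antisymm (hlower k hsol) hk]
  exact hsol
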